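/- For every n ∈ ℕ there exist a very-large family B of finite subsets of the cardinal ω_n and a function c : B → ℕ such that any two distinct sets s, t ∈ B with c(s) = c(t) are in (2n−1)-Δ-position; in other words, the positional graph G_{2n−1}(B) has countable chromatic number. -/

import Mathlib

/-- `s < t` for finite sets of ordinals. -/
def BlkLt (s t : Finset Ordinal) : Prop := ∀ a ∈ s, ∀ b ∈ t, a < b

/-- `s ⊑ t` : `s` is an initial part of `t`. -/
def InitSeg (s t : Finset Ordinal) : Prop := s ⊆ t ∧ BlkLt s (t \ s)

/-- `A` and `B` are in `n`-Δ-position. -/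
def DeltaPos (n : ℕ) (A B : Finset Ordinal) : Prop :=
  ∃ I J : Finset Ordinal, I ⊆ A ∩ B ∧ J ⊆ A ∩ B ∧ BlkLt I J ∧
    A ∩ B = I ∪ J ∧ J.card ≤ n ∧ InitSeg I A ∧ InitSeg I B

/-- A family `B` of finite subsets of (the ordinals below) `κ` is very-large if every
infinite subset `A` of `κ` has an infinite subset all of whose finite subsets are in `B`. -/
def VeryLarge (κo : Ordinal) (B : Set (Finset Ordinal)) : Prop :=
  ∀ A : Set Ordinal, A ⊆ Set.Iio κo → A.Infinite →
    ∃ A' ⊆ A, A'.Infinite ∧ ∀ s : Finset Ordinal, ↑s ⊆ A' → s ∈ B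

universe u

/-- Infinite Ramsey theorem for colorings of increasing `N`-tuples of natural numbers, which are
presented as colorings of sequences depending only on the first `N` terms. -/
theorem exists_strictMono_homogeneous {K : Type*} [Finite K] (N : ℕ) :
    ∀ χ : (ℕ → ℕ) → K, (∀ u v, (∀ i < N, u i = v i) → χ u = χ v) →
      ∃ φ : ℕ → ℕ, StrictMono φ ∧ ∃ c, ∀ u, StrictMono u → χ (φ ∘ u) = c := by
  induction N with
  | zero =>
    intro χ hχ
    exact ⟨id, strictMono_id, χ id, fun u _ => hχ _ _ (by simp)⟩
  | succ N ih =>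
    intro χ hχ
    have step : ∀ φ : {φ : ℕ → ℕ // StrictMono φ}, ∃ ψ : {ψ : ℕ → ℕ // StrictMono ψ}, ∃ c,
        ∀ u : ℕ → ℕ, StrictMono u →
          χ (fun i => if i = 0 then φ.1 0 else φ.1 (ψ.1 (u (i - 1)) + 1)) = c := by
      rintro ⟨φ, hφ⟩
      obtain ⟨ψ, hψ, c, hc⟩ := ih
        (fun v => χ (fun i => if i = 0 then φ 0 else φ (v (i - 1) + 1))) (by
          intro u v huv
          apply hχ
          intro i hi
          by_cases h : i = 0
          · simp [h]
          · simp [h, huv (i - 1) (by omega)])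
      exact ⟨⟨ψ, hψ⟩, c, hc⟩
    choose ψ c hc using step
    let Φ : ℕ → {φ : ℕ → ℕ // StrictMono φ} := fun k =>
      Nat.rec ⟨id, strictMono_id⟩ (fun _ φ => ⟨fun i => φ.1 ((ψ φ).1 i + 1), fun i j hij =>
        φ.2 (Nat.succ_lt_succ ((ψ φ).2 hij))⟩) k
    have hΦ : ∀ k i, (Φ (k + 1)).1 i = (Φ k).1 ((ψ (Φ k)).1 i + 1) := fun k i => rfl
    let m : ℕ → ℕ := fun k => (Φ k).1 0
    have hm : StrictMono m := strictMono_nat_of_lt_succ fun k => by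
      change (Φ k).1 0 < (Φ (k + 1)).1 0
      rw [hΦ]
      exact (Φ k).2 (Nat.succ_pos _)
    have hrange : ∀ k d i, ∃ j, (Φ (k + d)).1 i = (Φ k).1 j := by
      intro k d
      induction d with
      | zero => exact fun i => ⟨i, rfl⟩
      | succ d ihd =>
        intro i
        obtain ⟨j, hj⟩ := ihd ((ψ (Φ (k + d))).1 i + 1)
        exact ⟨j, by rw [← hj]; rfl⟩
    have hcol : ∀ k (u : ℕ → ℕ), StrictMono u → (∀ i, k < u i) →
        χ (fun i => if i = 0 then m k else m (u (i - 1))) = c (Φ k) := by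
      intro k u hu hk
      have : ∀ i, ∃ j, m (u i) = (Φ (k + 1)).1 j := by
        intro i
        obtain ⟨d, hd⟩ := Nat.exists_eq_add_of_lt (hk i)
        obtain ⟨j, hj⟩ := hrange (k + 1) d 0
        refine ⟨j, ?_⟩
        rw [← hj]
        change (Φ (u i)).1 0 = _
        rw [hd, show k + d + 1 = k + 1 + d by omega]
      choose w hw using this
      have hwm : StrictMono w := fun i j hij =>
        (Φ (k + 1)).2.lt_iff_lt.1 (by rw [← hw, ← hw]; exact hm (hu hij))
      rw [← hc (Φ k) w hwm]
      congr 1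
      funext i
      by_cases h : i = 0
      · simp [h, m]
      · simp only [h, if_false]
        rw [hw, hΦ]
    obtain ⟨d, hd⟩ := Finite.exists_infinite_fiber (fun k => c (Φ k))
    have hd' : ((fun k => c (Φ k)) ⁻¹' {d}).Infinite := Set.infinite_coe_iff.1 hd
    obtain ⟨θ, hθ, hθd⟩ := Filter.extraction_of_frequently_atTop
      (Nat.frequently_atTop_iff_infinite.2 hd')
    refine ⟨m ∘ θ, hm.comp hθ, d, fun u hu => ?_⟩
    have h := hcol (θ (u 0)) (fun i => θ (u (i + 1)))
      (fun i j hij => hθ (hu (Nat.succ_lt_succ hij))) (fun i => hθ (hu (Nat.succ_pos i)))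
    have h' : c (Φ (θ (u 0))) = d := hθd (u 0)
    rw [← h', ← h]
    congr 1
    funext i
    by_cases hi : i = 0
    · simp [hi]
    · simp only [hi, if_false, Function.comp]
      rw [Nat.sub_add_cancel (by omega)]

/-- A finite increasing tuple of natural numbers extends to an increasing sequence. -/
theorem exists_strictMono_extension (N : ℕ) (u : ℕ → ℕ) (hu : StrictMonoOn u (Set.Iio N)) :
    ∃ v : ℕ → ℕ, StrictMono v ∧ ∀ i < N, v i = u i := by
  refine ⟨fun i => if i < N then u i else i + ∑ j ∈ Finset.range N, u j, ?_, ?_⟩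
  · intro i j hij
    by_cases hj : j < N
    · have hi : i < N := hij.trans hj
      simpa [hi, hj] using hu hi hj hij
    · by_cases hi : i < N
      · have := Finset.single_le_sum (f := u) (fun _ _ => Nat.zero_le _) (Finset.mem_range.2 hi)
        simp only [hi, hj, if_true, if_false]
        omega
      · simp only [hi, hj, if_false]
        omega
  · intro i hi
    simp [hi]

/-- Increasing enumeration of a finite set by an initial segment of the natural numbers. -/
theorem Finset.exists_strictMonoOn_enum {X : Type*} [LinearOrder X] [Inhabited X]
    (s : Finset X) :
    ∃ σ : ℕ → X, StrictMonoOn σ (Set.Iio s.card) ∧ ∀ x, x ∈ s ↔ ∃ i < s.card, σ i = x := by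
  refine ⟨fun i => if h : i < s.card then s.orderEmbOfFin rfl ⟨i, h⟩ else default, ?_, ?_⟩
  · intro i hi j hj hij
    have hi' : i < s.card := hi
    have hj' : j < s.card := hj
    simpa [hi', hj'] using hij
  · intro x
    rw [← Finset.mem_coe, ← Finset.range_orderEmbOfFin s rfl]
    constructor
    · rintro ⟨i, rfl⟩
      exact ⟨i, i.2, by simp⟩
    · rintro ⟨i, hi, rfl⟩
      exact ⟨⟨i, hi⟩, by simp [hi]⟩

/-- Two increasing `(n + 1)`-tuples of natural numbers sit inside an increasing
`(2 * n + 2)`-tuple, which starts with the least of their first entries. -/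
theorem exists_common_refinement {n : ℕ} {u v : ℕ → ℕ} (hu : StrictMono u) (hv : StrictMono v)
    (huv : u 0 < v 0) :
    ∃ w : ℕ → ℕ, StrictMono w ∧ ∃ g h : Fin (n + 1) → Fin (2 * n + 2),
      (∀ i : Fin (n + 1), u i = w (g i)) ∧ (∀ i : Fin (n + 1), v i = w (h i)) ∧ (g 0 : ℕ) = 0 ∧ ∀ i, (h i : ℕ) ≠ 0 := by
  classical
  let W := (Finset.range (n + 1)).image u ∪ (Finset.range (n + 1)).image v
  have hW : W.card ≤ 2 * n + 2 := by
    refine (Finset.card_union_le _ _).trans ?_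
    have h1 := Finset.card_image_le (s := Finset.range (n + 1)) (f := u)
    have h2 := Finset.card_image_le (s := Finset.range (n + 1)) (f := v)
    rw [Finset.card_range] at h1 h2
    omega
  obtain ⟨σ, hσ, hmem⟩ := W.exists_strictMonoOn_enum
  obtain ⟨w, hw, hwσ⟩ := exists_strictMono_extension W.card σ hσ
  have hmin : ∀ x ∈ W, u 0 ≤ x := by
    intro x hx
    rcases Finset.mem_union.1 hx with hx | hx
    · obtain ⟨i, -, rfl⟩ := Finset.mem_image.1 hx
      exact hu.monotone (Nat.zero_le i)
    · obtain ⟨i, -, rfl⟩ := Finset.mem_image.1 hx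
      exact huv.le.trans (hv.monotone (Nat.zero_le i))
  have hidx : ∀ x ∈ W, ∃ j : Fin (2 * n + 2), x = w j := by
    intro x hx
    obtain ⟨j, hj, rfl⟩ := (hmem x).1 hx
    exact ⟨⟨j, by omega⟩, (hwσ j hj).symm⟩
  have huW : ∀ i : Fin (n + 1), u i ∈ W := fun i =>
    Finset.mem_union_left _ (Finset.mem_image_of_mem u (Finset.mem_range.2 i.2))
  have hvW : ∀ i : Fin (n + 1), v i ∈ W := fun i =>
    Finset.mem_union_right _ (Finset.mem_image_of_mem v (Finset.mem_range.2 i.2))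
  choose g hg using fun i => hidx _ (huW i)
  choose h hh using fun i => hidx _ (hvW i)
  have hw0 : u 0 ≤ w 0 := by
    have hpos : 0 < W.card := Finset.card_pos.2 ⟨_, huW 0⟩
    exact hmin _ ((hmem _).2 ⟨0, hpos, (hwσ 0 hpos).symm⟩)
  refine ⟨w, hw, g, h, hg, hh, ?_, fun i hi => ?_⟩
  · have h0 : u 0 = w (g 0) := by simpa using hg 0
    rw [h0] at hw0
    exact Nat.le_zero.1 (hw.le_iff_le.1 hw0)
  · have h1 := hh i
    rw [hi] at h1
    have h2 : w 0 ≤ w (g 0) := hw.monotone (Nat.zero_le _)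
    have h3 : u 0 = w (g 0) := by simpa using hg 0
    have h4 : v 0 ≤ v i := hv.monotone (Nat.zero_le _)
    omega

/-- Every infinite subset of a well-order contains an increasing sequence. -/
theorem Set.Infinite.exists_strictMono_seq {X : Type*} [LinearOrder X] [WellFoundedLT X]
    {A : Set X} (hA : A.Infinite) : ∃ b : ℕ → X, StrictMono b ∧ ∀ i, b i ∈ A := by
  let f := hA.natEmbedding
  obtain ⟨g, hg⟩ := exists_increasing_or_nonincreasing_subseq (· < ·) (fun i => (f i : X))
  rcases hg with hg | hg
  · exact ⟨fun i => f (g i), fun i j hij => hg i j hij, fun i => (f (g i)).2⟩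
  · exfalso
    have hanti : ∀ i, (f (g (i + 1)) : X) < f (g i) := by
      intro i
      refine lt_of_le_of_ne (not_lt.1 (hg i (i + 1) (Nat.lt_succ_self i))) fun h => ?_
      have := g.injective (f.injective (Subtype.ext h))
      omega
    exact (RelEmbedding.natGT (r := (· < ·)) (fun i => (f (g i) : X)) hanti).not_wellFounded
      wellFounded_lt

open Ordinal Cardinal in
/-- Simultaneous injections of all closed initial segments of the ordinals into the least
ordinals of the same cardinality. -/
theorem exists_injOn_Iic : ∃ e : Ordinal.{u} → Ordinal.{u} → Ordinal.{u},
    (∀ β, Set.InjOn (e β) (Set.Iic β)) ∧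
    ∀ β (k : ℕ), β < (aleph ((k + 1 : ℕ) : Ordinal)).ord → ∀ α, e β α < (aleph k).ord := by
  have key : ∀ β : Ordinal.{u}, ∃ f : Ordinal.{u} → Ordinal.{u}, Set.InjOn f (Set.Iic β) ∧
      ∀ k : ℕ, β < (aleph ((k + 1 : ℕ) : Ordinal)).ord → ∀ α, f α < (aleph k).ord := by
    intro β
    have hcard : #(Set.Iio (Order.succ β)) = #(Set.Iio (Order.succ β).card.ord) := by
      rw [Cardinal.mk_Iio_ordinal, Cardinal.mk_Iio_ordinal, card_ord]
    obtain ⟨E⟩ := Cardinal.eq.1 hcard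
    refine ⟨fun α => if h : α < Order.succ β then E ⟨α, h⟩ else 0, ?_, ?_⟩
    · intro α hα α' hα' h
      have h1 : α < Order.succ β := Order.lt_succ_iff.2 hα
      have h2 : α' < Order.succ β := Order.lt_succ_iff.2 hα'
      simp only [h1, h2, dif_pos] at h
      exact congrArg Subtype.val (E.injective (Subtype.ext h))
    · intro k hk α
      have hle : (Order.succ β).card ≤ aleph k := by
        rw [lt_ord, Nat.cast_succ, ← succ_aleph, Order.lt_succ_iff] at hk
        rw [Order.succ_eq_add_one, Ordinal.card_add_one]
        exact add_le_of_le (aleph0_le_aleph _) hk (one_le_aleph0.trans (aleph0_le_aleph _))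
      by_cases h : α < Order.succ β
      · simp only [h, dif_pos]
        exact lt_of_lt_of_le (E ⟨α, h⟩).2 (ord_le_ord.2 hle)
      · simp only [h, dif_neg, not_false_eq_true]
        refine lt_of_lt_of_le omega0_pos ?_
        rw [← ord_aleph0]
        exact ord_le_ord.2 (aleph0_le_aleph _)
  choose e he using key
  exact ⟨e, fun β => (he β).1, fun β => (he β).2⟩

/-- Iterated descent of an increasing tuple `a 0 < a 1 < ⋯`: consecutive values at stage `k` are
compared by `e`, so that stage `k` depends on the first `k + 1` entries only. -/
def descent (e : Ordinal.{u} → Ordinal.{u} → Ordinal.{u}) : ℕ → (ℕ → Ordinal.{u}) → Ordinal.{u}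
  | 0, a => a 0
  | k + 1, a => e (descent e k fun i => a (i + 1)) (descent e k a)

section Descent

variable {e : Ordinal.{u} → Ordinal.{u} → Ordinal.{u}}

theorem descent_congr {k : ℕ} {a b : ℕ → Ordinal.{u}} (h : ∀ i ≤ k, a i = b i) :
    descent e k a = descent e k b := by
  induction k generalizing a b with
  | zero => exact h 0 le_rfl
  | succ k ih =>
    simp only [descent]
    rw [ih fun i hi => h i (by omega), ih fun i hi => h (i + 1) (by omega)]

theorem descent_lt
    (he : ∀ β (k : ℕ), β < (Cardinal.aleph ((k + 1 : ℕ) : Ordinal)).ord →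
      ∀ α, e β α < (Cardinal.aleph k).ord)
    {k m : ℕ} {a : ℕ → Ordinal.{u}}
    (h : ∀ i ≤ k, a i < (Cardinal.aleph ((k + m : ℕ) : Ordinal)).ord) :
    descent e k a < (Cardinal.aleph m).ord := by
  induction k generalizing a m with
  | zero => simpa [descent] using h 0 le_rfl
  | succ k ih =>
    refine he _ _ (ih fun i hi => ?_) _
    rw [show k + (m + 1) = k + 1 + m by omega]
    exact h (i + 1) (by omega)

/-- The first entry of a tuple is recovered from the other entries and the last stage. -/
theorem eq_of_descent_eq (he : ∀ β, Set.InjOn (e β) (Set.Iic β)) {n : ℕ} {a b : ℕ → Ordinal.{u}}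
    (ha : ∀ k < n, descent e k a ≤ descent e k fun i => a (i + 1))
    (hb : ∀ k < n, descent e k b ≤ descent e k fun i => b (i + 1))
    (hab : ∀ i < n, a (i + 1) = b (i + 1)) (h : descent e n a = descent e n b) :
    a 0 = b 0 := by
  induction n with
  | zero => exact h
  | succ n ih =>
    refine ih (fun k hk => ha k (by omega)) (fun k hk => hb k (by omega))
      (fun i hi => hab i (by omega)) ?_
    have htail : descent e n (fun i => a (i + 1)) = descent e n fun i => b (i + 1) :=
      descent_congr fun i hi => hab i (by omega)
    simp only [descent] at h
    rw [← htail] at h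
    refine he _ (ha n (by omega)) ?_ h
    rw [htail]
    exact hb n (by omega)

/-- The sequence `a` starts with an increasing `(n + 1)`-tuple of elements of `S`. -/
def IsTuple (n : ℕ) (S : Set Ordinal.{u}) (a : ℕ → Ordinal.{u}) : Prop :=
  StrictMonoOn a (Set.Iic n) ∧ ∀ i ≤ n, a i ∈ S

/-- On tuples of elements of `S`, each stage of the descent grows when the tuple is shifted, and
the last stage determines the first entry. -/
def IsTame (e : Ordinal.{u} → Ordinal.{u} → Ordinal.{u}) (n : ℕ) (S : Set Ordinal.{u}) : Prop :=
  (∀ a, IsTuple n S a → ∀ k < n, descent e k a ≤ descent e k fun i => a (i + 1)) ∧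
  ∀ a b, IsTuple n S a → IsTuple n S b → descent e n a = descent e n b → a 0 = b 0

theorem IsTame.mono {n : ℕ} {S T : Set Ordinal.{u}} (hT : IsTame e n T) (h : S ⊆ T) :
    IsTame e n S :=
  ⟨fun a ha => hT.1 a ⟨ha.1, fun i hi => h (ha.2 i hi)⟩,
    fun a b ha hb => hT.2 a b ⟨ha.1, fun i hi => h (ha.2 i hi)⟩
      ⟨hb.1, fun i hi => h (hb.2 i hi)⟩⟩

/-- A tuple of elements of the range of an increasing sequence comes from an increasing sequence
of indices. -/
theorem IsTuple.exists_index {n : ℕ} {b : ℕ → Ordinal.{u}} (hb : StrictMono b)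
    {a : ℕ → Ordinal.{u}} (ha : IsTuple n (Set.range b) a) :
    ∃ u : ℕ → ℕ, StrictMono u ∧ ∀ i ≤ n, a i = b (u i) := by
  have : ∀ i, ∃ j, i ≤ n → b j = a i := fun i => by
    by_cases hi : i ≤ n
    · obtain ⟨j, hj⟩ := ha.2 i hi
      exact ⟨j, fun _ => hj⟩
    · exact ⟨0, fun h => absurd h hi⟩
  choose w hw using this
  obtain ⟨u, hu, huw⟩ := exists_strictMono_extension (n + 1) w (by
    intro i hi j hj hij
    have hi' : i ≤ n := Nat.lt_succ_iff.1 hi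
    have hj' : j ≤ n := Nat.lt_succ_iff.1 hj
    rw [← hb.lt_iff_lt, hw i hi', hw j hj']
    exact ha.1 hi' hj' hij)
  exact ⟨u, hu, fun i hi => by rw [huw i (by omega), hw i hi]⟩

/-- Every increasing sequence of ordinals has a subsequence with tame range. -/
theorem exists_subseq_isTame (he : ∀ β, Set.InjOn (e β) (Set.Iic β)) (n : ℕ)
    {b : ℕ → Ordinal.{u}} (hb : StrictMono b) :
    ∃ φ : ℕ → ℕ, StrictMono φ ∧ IsTame e n (Set.range fun i => b (φ i)) := by
  let ext : (Fin (n + 1) → Fin (2 * n + 2)) → ℕ → ℕ := fun g i => g (Fin.ofNat (n + 1) i)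
  have hext : ∀ g i (hi : i ≤ n), ext g i = g ⟨i, by omega⟩ := by
    intro g i hi
    have : Fin.ofNat (n + 1) i = ⟨i, by omega⟩ := Fin.ext (Nat.mod_eq_of_lt (by omega))
    simp only [ext, this]
  let χ : (ℕ → ℕ) → ((Fin (n + 1) → Fin (2 * n + 2)) × (Fin (n + 1) → Fin (2 * n + 2)) → Prop) ×
      (Fin n → Prop) := fun u =>
    (fun p => (descent e n fun i => b (u (ext p.1 i))) = descent e n fun i => b (u (ext p.2 i)),
      fun k => (descent e k fun i => b (u i)) ≤ descent e k fun i => b (u (i + 1)))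
  obtain ⟨φ, hφ, c, hc⟩ := exists_strictMono_homogeneous (2 * n + 2) χ (by
    intro u v huv
    refine Prod.ext (funext fun p => ?_) (funext fun k => ?_)
    · have : ∀ g i, b (u (ext g i)) = b (v (ext g i)) := fun g i => by rw [huv _ (Fin.is_lt _)]
      simp only [χ, this]
    · have hk := k.2
      have h1 : (descent e k fun i => b (u i)) = descent e k fun i => b (v i) :=
        descent_congr fun i hi => by rw [huv i (by omega)]
      have h2 : (descent e k fun i => b (u (i + 1))) = descent e k fun i => b (v (i + 1)) :=
        descent_congr fun i hi => by rw [huv (i + 1) (by omega)]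
      simp only [χ, h1, h2])
  have hbφ : StrictMono fun i => b (φ i) := hb.comp hφ
  have hgrow : ∀ a, IsTuple n (Set.range fun i => b (φ i)) a →
      ∀ k < n, descent e k a ≤ descent e k fun i => a (i + 1) := by
    intro a ha k hk
    obtain ⟨u, hu, hau⟩ := ha.exists_index hbφ
    rw [descent_congr (e := e) (b := fun i => b (φ (u i))) fun i hi => hau i (by omega),
      descent_congr (e := e) (b := fun i => b (φ (u (i + 1)))) fun i hi => hau (i + 1) (by omega)]
    have hcol : ∀ v : ℕ → ℕ, StrictMono v →
        (((descent e k fun i => b (φ (v i))) ≤ descent e k fun i => b (φ (v (i + 1)))) ↔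
          c.2 ⟨k, hk⟩) := fun v hv => by
      have := congrFun (congrArg Prod.snd (hc v hv)) ⟨k, hk⟩
      exact iff_of_eq this
    by_contra hcon
    have hc' : ¬ c.2 ⟨k, hk⟩ := fun h => hcon ((hcol u hu).2 h)
    have hdesc : ∀ m : ℕ, (descent e k fun i => b (φ (i + (m + 1)))) <
        descent e k fun i => b (φ (i + m)) := fun m => by
      have := not_le.1 fun h => hc' ((hcol (fun i => i + m) fun i j hij => by simpa using hij).1 h)
      simpa only [add_assoc, add_comm m 1] using this
    exact (RelEmbedding.natGT (r := (· < ·)) (fun m => descent e k fun i => b (φ (i + m)))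
      hdesc).not_wellFounded wellFounded_lt
  have hne : ∀ u v : ℕ → ℕ, StrictMono u → StrictMono v → u 0 < v 0 →
      (descent e n fun i => b (φ (u i))) ≠ descent e n fun i => b (φ (v i)) := by
    intro u v hu hv huv heq
    obtain ⟨w, hw, g, h, hg, hh, hg0, hh0⟩ := exists_common_refinement (n := n) hu hv huv
    have hcol : ∀ w' : ℕ → ℕ, StrictMono w' →
        (((descent e n fun i => b (φ (w' (ext g i)))) = descent e n fun i => b (φ (w' (ext h i)))) ↔
          c.1 (g, h)) := fun w' hw' => by
      have := congrFun (congrArg Prod.fst (hc w' hw')) (g, h)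
      exact iff_of_eq this
    have hcgh : c.1 (g, h) := by
      have h1 : (descent e n fun i => b (φ (w (ext g i)))) = descent e n fun i => b (φ (u i)) :=
        descent_congr fun i hi => by rw [hext g i hi, ← hg ⟨i, Nat.lt_succ_of_le hi⟩]
      have h2 : (descent e n fun i => b (φ (w (ext h i)))) = descent e n fun i => b (φ (v i)) :=
        descent_congr fun i hi => by rw [hext h i hi, ← hh ⟨i, Nat.lt_succ_of_le hi⟩]
      rw [← hcol w hw, h1, h2]
      exact heq
    have hgmono : StrictMonoOn (ext g) (Set.Iic n) := by
      intro i hi j hj hij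
      rw [hext g i hi, hext g j hj, ← hw.lt_iff_lt, ← hg, ← hg]
      exact hu hij
    have htuple : ∀ w' : ℕ → ℕ, StrictMono w' →
        IsTuple n (Set.range fun i => b (φ i)) fun i => b (φ (w' (ext g i))) := fun w' hw' =>
      ⟨fun i hi j hj hij => hbφ (hw' (hgmono hi hj hij)), fun i _ => ⟨_, rfl⟩⟩
    have hw₁ : StrictMono fun i : ℕ => i + 1 := fun i j hij => by simpa using hij
    have hw₂ : StrictMono fun i : ℕ => if i = 0 then 0 else i + 1 := fun i j hij => by
      have hj : j ≠ 0 := by omega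
      by_cases hi : i = 0 <;> simp [hi, hj, hij]
    have hg0' : ext g 0 = 0 := by rw [hext g 0 (Nat.zero_le n)]; exact hg0
    have hpos : ∀ i < n, ext g (i + 1) ≠ 0 := fun i hi h0 => by
      have := hgmono (Set.mem_Iic.2 (Nat.zero_le n)) (Set.mem_Iic.2 hi) (Nat.succ_pos i)
      rw [Nat.succ_eq_add_one, h0] at this
      exact absurd this (Nat.not_lt_zero _)
    have := eq_of_descent_eq he (hgrow _ (htuple _ hw₁)) (hgrow _ (htuple _ hw₂))
      (fun i hi => by simp [hpos i hi]) (by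
        rw [(hcol _ hw₁).2 hcgh, (hcol _ hw₂).2 hcgh]
        exact descent_congr fun i hi => by
          have := hh0 ⟨i, by omega⟩
          rw [hext h i hi]
          simp [this])
    simp only [hg0'] at this
    exact absurd (hbφ.injective this) (by simp)
  refine ⟨φ, hφ, hgrow, fun a a' ha ha' heq => ?_⟩
  obtain ⟨u, hu, hau⟩ := ha.exists_index hbφ
  obtain ⟨v, hv, hav⟩ := ha'.exists_index hbφ
  rw [descent_congr hau, descent_congr hav] at heq
  rw [hau 0 (Nat.zero_le n), hav 0 (Nat.zero_le n)]
  rcases lt_trichotomy (u 0) (v 0) with h | h | h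
  · exact absurd heq (hne u v hu hv h)
  · rw [h]
  · exact absurd heq.symm (hne v u hv hu h)

/-- Two enumerated sets of the same size whose tuples have equal descents agree at every position
below `n` common positions. -/
theorem enum_eq_of_agree (he : ∀ β, Set.InjOn (e β) (Set.Iic β)) {n m : ℕ} {S T : Set Ordinal.{u}}
    (hS : IsTame e n S) (hT : IsTame e n T) {σ τ : ℕ → Ordinal.{u}}
    (hσ : StrictMonoOn σ (Set.Iio m)) (hτ : StrictMonoOn τ (Set.Iio m))
    (hσS : ∀ i < m, σ i ∈ S) (hτT : ∀ i < m, τ i ∈ T)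
    (hcol : ∀ g : ℕ → ℕ, (∀ i ≤ n, g i < m) →
      descent e n (fun i => σ (g i)) = descent e n fun i => τ (g i))
    {G : ℕ → ℕ} (hG : StrictMonoOn G (Set.Iio n)) (hGm : ∀ j < n, G j < m)
    (hagree : ∀ j < n, σ (G j) = τ (G j)) {i : ℕ} (him : i < m) (hi : 0 < n → i < G 0) :
    σ i = τ i := by
  let g : ℕ → ℕ := fun j => if j = 0 then i else G (j - 1)
  have hgm : ∀ j ≤ n, g j < m := fun j hj => by
    by_cases h : j = 0
    · simpa [g, h] using him
    · simpa [g, h] using hGm (j - 1) (by omega)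
  have hgmono : StrictMonoOn g (Set.Iic n) := by
    intro j hj k hk hjk
    have hk' : k ≤ n := hk
    have hk0 : k ≠ 0 := by omega
    by_cases h : j = 0
    · simp only [g, h, hk0, if_true, if_false]
      refine (hi (by omega)).trans_le (hG.monotoneOn ?_ ?_ (Nat.zero_le _))
      · exact Set.mem_Iio.2 (by omega)
      · exact Set.mem_Iio.2 (by omega)
    · simp only [g, h, hk0, if_false]
      exact hG (Set.mem_Iio.2 (by omega)) (Set.mem_Iio.2 (by omega)) (by omega)
  have h := eq_of_descent_eq he
    (hS.1 (fun j => σ (g j)) ⟨fun j hj k hk hjk => hσ (hgm j hj) (hgm k hk) (hgmono hj hk hjk),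
      fun j hj => hσS _ (hgm j hj)⟩)
    (hT.1 (fun j => τ (g j)) ⟨fun j hj k hk hjk => hτ (hgm j hj) (hgm k hk) (hgmono hj hk hjk),
      fun j hj => hτT _ (hgm j hj)⟩)
    (fun j hj => by simpa [g] using hagree j hj) (hcol g hgm)
  simpa [g] using h

/-- Tame sets of the same size whose tuples have equal descents are in `(2 * n - 1)`-Δ-position. -/
theorem deltaPos_of_descent_eq (he : ∀ β, Set.InjOn (e β) (Set.Iic β)) {n : ℕ}
    {s t : Finset Ordinal.{u}} (hs : IsTame e n (s : Set Ordinal.{u}))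
    (ht : IsTame e n (t : Set Ordinal.{u})) {m : ℕ} {σ τ : ℕ → Ordinal.{u}}
    (hσ : StrictMonoOn σ (Set.Iio m)) (hτ : StrictMonoOn τ (Set.Iio m))
    (hσs : ∀ x, x ∈ s ↔ ∃ i < m, σ i = x) (hτt : ∀ x, x ∈ t ↔ ∃ i < m, τ i = x)
    (hcol : ∀ g : ℕ → ℕ, (∀ i ≤ n, g i < m) →
      descent e n (fun i => σ (g i)) = descent e n fun i => τ (g i))
    (hst : s ≠ t) : DeltaPos (2 * n - 1) s t := by
  have hσmem : ∀ i < m, σ i ∈ (s : Set Ordinal.{u}) := fun i hi => (hσs _).2 ⟨i, hi, rfl⟩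
  have hτmem : ∀ i < m, τ i ∈ (t : Set Ordinal.{u}) := fun i hi => (hτt _).2 ⟨i, hi, rfl⟩
  rcases Nat.eq_zero_or_pos n with rfl | hn
  · refine absurd (Finset.ext fun x => ?_) hst
    have heq : ∀ i < m, σ i = τ i := fun i hi =>
      enum_eq_of_agree he hs ht hσ hτ hσmem hτmem hcol (G := id)
        (fun _ h => absurd h (Nat.not_lt_zero _)) (fun _ h => absurd h (Nat.not_lt_zero _))
        (fun _ h => absurd h (Nat.not_lt_zero _)) hi (fun h => absurd h (Nat.not_lt_zero _))
    rw [hσs, hτt]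
    exact exists_congr fun i => and_congr_right fun hi => by rw [heq i hi]
  set r := (s ∩ t).card with hr
  by_cases hsmall : r ≤ 2 * n - 1
  · exact ⟨∅, s ∩ t, by simp, le_rfl, by simp [BlkLt], by simp, hsmall,
      by simp [InitSeg, BlkLt], by simp [InitSeg, BlkLt]⟩
  obtain ⟨h, hh, hmem⟩ := (s ∩ t).exists_strictMonoOn_enum
  rw [← hr] at hh hmem
  have hP : ∀ l, ∃ i, l < r → i < m ∧ σ i = h l := fun l => by
    by_cases hl : l < r
    · obtain ⟨i, hi⟩ := (hσs (h l)).1 (Finset.mem_inter.1 ((hmem _).2 ⟨l, hl, rfl⟩)).1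
      exact ⟨i, fun _ => hi⟩
    · exact ⟨0, fun h => absurd h hl⟩
  have hQ : ∀ l, ∃ i, l < r → i < m ∧ τ i = h l := fun l => by
    by_cases hl : l < r
    · obtain ⟨i, hi⟩ := (hτt (h l)).1 (Finset.mem_inter.1 ((hmem _).2 ⟨l, hl, rfl⟩)).2
      exact ⟨i, fun _ => hi⟩
    · exact ⟨0, fun h => absurd h hl⟩
  choose P hP using hP
  choose Q hQ using hQ
  have hPmono : StrictMonoOn P (Set.Iio r) := fun i hi j hj hij => by
    rw [← hσ.lt_iff_lt (hP i hi).1 (hP j hj).1, (hP i hi).2, (hP j hj).2]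
    exact hh hi hj hij
  have hQmono : StrictMonoOn Q (Set.Iio r) := fun i hi j hj hij => by
    rw [← hτ.lt_iff_lt (hQ i hi).1 (hQ j hj).1, (hQ i hi).2, (hQ j hj).2]
    exact hh hi hj hij
  have hPQ : ∀ l, l + n < r → P l = Q l := by
    intro l hl
    have htuple : ∀ R : ℕ → ℕ, StrictMonoOn R (Set.Iio r) → (∀ i < r, R i < m) →
        IsTuple n (s : Set Ordinal.{u}) fun i => σ (R (l + i)) := fun R hR hRm =>
      ⟨fun i hi j hj hij => by
        have hi' : i ≤ n := hi
        have hj' : j ≤ n := hj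
        exact hσ (hRm _ (by omega)) (hRm _ (by omega))
          (hR (Set.mem_Iio.2 (by omega)) (Set.mem_Iio.2 (by omega)) (by omega)),
        fun i hi => hσmem _ (hRm _ (by omega))⟩
    have heq := hs.2 _ _ (htuple P hPmono fun i hi => (hP i hi).1)
      (htuple Q hQmono fun i hi => (hQ i hi).1) (by
        rw [hcol (fun i => Q (l + i)) fun i hi => (hQ _ (by omega)).1]
        exact descent_congr fun i hi => by rw [(hP _ (by omega)).2, (hQ _ (by omega)).2])
    exact hσ.injOn (hP l (by omega)).1 (hQ l (by omega)).1 heq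
  have hagree : ∀ j < n, σ (P (r - 2 * n + j)) = τ (P (r - 2 * n + j)) := fun j hj => by
    rw [(hP _ (by omega)).2, hPQ _ (by omega), (hQ _ (by omega)).2]
  have hPσ : σ (P (r - 2 * n)) = h (r - 2 * n) := (hP _ (by omega)).2
  have hPm : P (r - 2 * n) < m := (hP _ (by omega)).1
  have hPτ : τ (P (r - 2 * n)) = h (r - 2 * n) := by rw [← hPσ]; exact (hagree 0 hn).symm
  have hbelow : ∀ i < P (r - 2 * n), σ i = τ i := fun i hi =>
    enum_eq_of_agree he hs ht hσ hτ hσmem hτmem hcol (G := fun j => P (r - 2 * n + j))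
      (fun j hj k hk hjk => by
        have hj' : j < n := hj
        have hk' : k < n := hk
        exact hPmono (Set.mem_Iio.2 (by omega)) (Set.mem_Iio.2 (by omega)) (by omega))
      (fun j hj => (hP _ (by omega)).1) hagree (hi.trans hPm) fun _ => hi
  have hγ : h (r - 2 * n) ∈ s ∩ t := (hmem _).2 ⟨_, by omega, rfl⟩
  have hst' : ∀ x ∈ s, x ≤ h (r - 2 * n) → x ∈ t := fun x hx hle => by
    rcases hle.eq_or_lt with rfl | hlt
    · exact (Finset.mem_inter.1 hγ).2
    · obtain ⟨i, hi, rfl⟩ := (hσs x).1 hx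
      rw [← hPσ, hσ.lt_iff_lt hi hPm] at hlt
      rw [hbelow i hlt]
      exact hτmem i hi
  have hts' : ∀ x ∈ t, x ≤ h (r - 2 * n) → x ∈ s := fun x hx hle => by
    rcases hle.eq_or_lt with rfl | hlt
    · exact (Finset.mem_inter.1 hγ).1
    · obtain ⟨i, hi, rfl⟩ := (hτt x).1 hx
      rw [← hPτ, hτ.lt_iff_lt hi hPm] at hlt
      rw [← hbelow i hlt]
      exact hσmem i hi
  refine ⟨(s ∩ t).filter (· ≤ h (r - 2 * n)), (s ∩ t).filter (h (r - 2 * n) < ·),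
    Finset.filter_subset _ _, Finset.filter_subset _ _, ?_, ?_, ?_, ?_, ?_⟩
  · intro a ha b hb
    exact (Finset.mem_filter.1 ha).2.trans_lt (Finset.mem_filter.1 hb).2
  · ext x
    simp only [Finset.mem_union, Finset.mem_filter, ← and_or_left, le_or_gt, and_true]
  · have hsub : (s ∩ t).filter (h (r - 2 * n) < ·) ⊆
        (Finset.Ico (r - 2 * n + 1) r).image h := by
      intro x hx
      obtain ⟨hx, hlt⟩ := Finset.mem_filter.1 hx
      obtain ⟨i, hi, rfl⟩ := (hmem x).1 hx
      rw [hh.lt_iff_lt (Set.mem_Iio.2 (by omega)) hi] at hlt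
      exact Finset.mem_image_of_mem h (Finset.mem_Ico.2 ⟨hlt, hi⟩)
    refine (Finset.card_le_card hsub).trans (Finset.card_image_le.trans ?_)
    rw [Nat.card_Ico]
    omega
  · refine ⟨fun x hx => (Finset.mem_inter.1 (Finset.mem_filter.1 hx).1).1, fun a ha b hb => ?_⟩
    obtain ⟨hbs, hb⟩ := Finset.mem_sdiff.1 hb
    refine (Finset.mem_filter.1 ha).2.trans_lt (not_le.1 fun hle => hb ?_)
    exact Finset.mem_filter.2 ⟨Finset.mem_inter.2 ⟨hbs, hst' b hbs hle⟩, hle⟩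
  · refine ⟨fun x hx => (Finset.mem_inter.1 (Finset.mem_filter.1 hx).1).2, fun a ha b hb => ?_⟩
    obtain ⟨hbt, hb⟩ := Finset.mem_sdiff.1 hb
    refine (Finset.mem_filter.1 ha).2.trans_lt (not_le.1 fun hle => hb ?_)
    exact Finset.mem_filter.2 ⟨Finset.mem_inter.2 ⟨hts' b hbt hle, hbt⟩, hle⟩

end Descent

/-- For every `n` there is a very-large family `B` of finite subsets of `ω_n` and a
coloring `c : B → ℕ` such that any two distinct sets of `B` of the same color are in
`(2n-1)`-Δ-position: the positional graph `G_{2n-1}(B)` has countable chromatic number. -/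
theorem stmt2 (n : ℕ) :
    ∃ B : Set (Finset Ordinal),
      (∀ s ∈ B, ∀ a ∈ s, a < (Cardinal.aleph n).ord) ∧
      VeryLarge (Cardinal.aleph n).ord B ∧
      ∃ c : Finset Ordinal → ℕ,
        ∀ s ∈ B, ∀ t ∈ B, s ≠ t → c s = c t → DeltaPos (2 * n - 1) s t := by
  obtain ⟨e, he, he_lt⟩ := exists_injOn_Iic
  refine ⟨{s | (∀ a ∈ s, a < (Cardinal.aleph n).ord) ∧ IsTame e n (s : Set Ordinal)},
    fun s hs => hs.1, ?_, ?_⟩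
  · intro A hA hinf
    obtain ⟨b, hb, hbA⟩ := hinf.exists_strictMono_seq
    obtain ⟨φ, hφ, htame⟩ := exists_subseq_isTame he n hb
    have hsub : (Set.range fun i => b (φ i)) ⊆ A := by
      rintro _ ⟨i, rfl⟩
      exact hbA _
    exact ⟨_, hsub, Set.infinite_range_of_injective (hb.comp hφ).injective, fun s hs =>
      ⟨fun a ha => hA (hsub (hs ha)), htame.mono hs⟩⟩
  · choose σ hσ hσmem using fun s : Finset Ordinal => s.exists_strictMonoOn_enum
    obtain ⟨ν, hν⟩ : ∃ ν : Ordinal → ℕ, Set.InjOn ν (Set.Iio (Cardinal.aleph (0 : ℕ)).ord) := by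
      refine Set.countable_iff_exists_injOn.1 ?_
      rw [← Cardinal.le_aleph0_iff_set_countable, Cardinal.mk_Iio_ordinal]
      simp
    obtain ⟨enc, henc⟩ := exists_injective_nat (ℕ × Finset ((Fin (n + 1) → ℕ) × ℕ))
    let val : Finset Ordinal → (Fin (n + 1) → ℕ) → ℕ := fun s g =>
      ν (descent e n fun i => σ s (g (Fin.ofNat (n + 1) i)))
    refine ⟨fun s => enc (s.card,
      (Fintype.piFinset fun _ => Finset.range s.card).image fun g => (g, val s g)), ?_⟩
    intro s hs t ht hst hc
    obtain ⟨hcard, himage⟩ := Prod.mk.inj (henc hc)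
    refine deltaPos_of_descent_eq he hs.2 ht.2 (hσ s) (hcard ▸ hσ t) (hσmem s)
      (by rw [hcard]; exact hσmem t) (fun g hg => ?_) hst
    have hmem : ((fun i : Fin (n + 1) => g i), val s fun i => g i) ∈
        (Fintype.piFinset fun _ => Finset.range t.card).image fun g => (g, val t g) := by
      rw [← himage]
      refine Finset.mem_image_of_mem _ (Fintype.mem_piFinset.2 fun i => Finset.mem_range.2 ?_)
      exact hg i (Nat.lt_succ_iff.1 i.2)
    obtain ⟨g', -, hg'⟩ := Finset.mem_image.1 hmem
    obtain ⟨rfl, hval⟩ := Prod.mk.inj hg'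
    have hgi : ∀ i ≤ n, ((Fin.ofNat (n + 1) i : Fin (n + 1)) : ℕ) = i := fun i hi =>
      Nat.mod_eq_of_lt (by omega)
    have hrestrict : ∀ w : Finset Ordinal,
        (descent e n fun i => σ w (g (Fin.ofNat (n + 1) i : Fin (n + 1)))) =
          descent e n fun i => σ w (g i) := fun w =>
      descent_congr fun i hi => by rw [hgi i hi]
    have hlt : ∀ w : Finset Ordinal, w.card = s.card → (∀ a ∈ w, a < (Cardinal.aleph n).ord) →
        (descent e n fun i => σ w (g i)) < (Cardinal.aleph (0 : ℕ)).ord := fun w hw hwlt =>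
      descent_lt he_lt fun i hi => hwlt _ ((hσmem w _).2 ⟨g i, by rw [hw]; exact hg i hi, rfl⟩)
    simp only [val, hrestrict] at hval
    exact (hν (hlt t hcard.symm ht.1) (hlt s rfl hs.1) hval).symm
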